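/- There exist ε > 0 and a universal constant C > 0 such that the following holds for all ν ≥ 0, t ≥ 0 and all A_μ ∈ [−1,1]. Let f be a 2π-periodic real function with ‖f‖_{F^{1,1}_ν} ≤ ε and ‖f‖_{Ḟ^{2,1}_ν} < ∞, let F be a 2π-periodic real function with mean zero and ‖F‖_{Ḟ^{1,1}_ν} < ∞, and let g be a 2π-periodic real function with mean zero and ‖g‖_{Ḟ^{1,1}_ν} < ∞ that solves g = 2A_μ D[f](g) + F. Then ‖g‖_{Ḟ^{1,1}_ν} ≤ C ( ‖f‖_{Ḟ^{2,1}_ν} ‖F‖_{Ḟ^{0,1}_ν} + ‖F‖_{Ḟ^{1,1}_ν} ). -/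

import Mathlib

open MeasureTheory Filter

/-- The `k`-th Fourier coefficient of a `2π`-periodic function `f : ℝ → ℝ`. -/
noncomputable def fourierCoef (f : ℝ → ℝ) (k : ℤ) : ℂ :=
  (1 / (2 * Real.pi)) * ∫ α in (-Real.pi)..Real.pi, (f α : ℂ) * Complex.exp (-Complex.I * k * α)

/-- The homogeneous analytic Wiener seminorm `‖f‖_{Ḟ^{s,1}_ν}` at time `t`. -/
noncomputable def wienerNorm (ν t s : ℝ) (f : ℝ → ℝ) : ENNReal :=
  ∑' k : ℤ, if k = 0 then 0 else
    ENNReal.ofReal (Real.exp (ν * |(k : ℝ)| * t) * |(k : ℝ)| ^ s *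
      ‖fourierCoef f k‖)

/-- The nonhomogeneous analytic Wiener norm `‖f‖_{F^{s,1}_ν}` at time `t`. -/
noncomputable def wienerNormF (ν t s : ℝ) (f : ℝ → ℝ) : ENNReal :=
  ENNReal.ofReal ‖fourierCoef f 0‖ + wienerNorm ν t s f

/-- The kernel (integrand) of the operator `D[f]` applied to `g`, at base point `α`
and integration variable `β`; here `Δ = Δ_βf(α) = (f(α−β) − f(α))/(2 sin(β/2))`. -/
noncomputable def Dker (f g : ℝ → ℝ) (α β : ℝ) : ℝ :=
  (((1 + f α) * (1 + f (α - β)) * Real.sin (β / 2) +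
      (1 + f α) * ((f (α - β) - f α) / (2 * Real.sin (β / 2)))) /
     (((f (α - β) - f α) / (2 * Real.sin (β / 2))) ^ 2 + (1 + f α) * (1 + f (α - β))) -
   (1 + f (α - β)) * deriv f α * Real.cos (β / 2) /
     (((f (α - β) - f α) / (2 * Real.sin (β / 2))) ^ 2 + (1 + f α) * (1 + f (α - β)))) *
    g (α - β) / (2 * Real.sin (β / 2))

/-- The truncated integrals whose limit as `ε → 0⁺` defines `D[f](g)(α)`. -/
noncomputable def Dapprox (f g : ℝ → ℝ) (α ε : ℝ) : ℝ :=
  (1 / (2 * Real.pi)) *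
    ((∫ β in ε..Real.pi, Dker f g α β) + ∫ β in (-Real.pi)..(-ε), Dker f g α β)

/-- `IsD f g h` says that `h = D[f](g)` in the principal value sense:
for every `α`, the truncated integrals converge to `h(α)` as `ε → 0⁺`. -/
def IsD (f g h : ℝ → ℝ) : Prop :=
  ∀ α : ℝ, Tendsto (fun ε => Dapprox f g α ε) (nhdsWithin 0 (Set.Ioi 0)) (nhds (h α))

/-! ### Absolutely convergent double Fourier series -/

/-- The weight `e^{ω|k|} (1 + δ (|k| + |m|))` on double Fourier frequencies. -/
noncomputable def wienerWeight (ω δ : ℝ) (k m : ℤ) : ℝ :=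
  Real.exp (ω * |(k : ℝ)|) * (1 + δ * (|(k : ℝ)| + |(m : ℝ)|))

/-- The character `e^{i(kα - mβ)}`. -/
noncomputable def doubleChar (k m : ℤ) (α β : ℝ) : ℂ :=
  Complex.exp (Complex.I * (k * α - m * β))

/-- `G` is the sum of a double Fourier series whose weighted `ℓ¹` norm is at most `c`. -/
def IsWiener (ω δ : ℝ) (G : ℝ → ℝ → ℂ) (c : ℝ) : Prop :=
  ∃ (ι : Type) (_ : Countable ι) (a : ι → ℂ) (k m : ι → ℤ),
    ∑' i, ENNReal.ofReal (wienerWeight ω δ (k i) (m i) * ‖a i‖) ≤ ENNReal.ofReal c ∧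
    ∀ α β, HasSum (fun i => a i * doubleChar (k i) (m i) α β) (G α β)

lemma norm_doubleChar (k m : ℤ) (α β : ℝ) : ‖doubleChar k m α β‖ = 1 := by
  have : doubleChar k m α β = Complex.exp (((k * α - m * β : ℝ) : ℂ) * Complex.I) := by
    unfold doubleChar; congr 1; push_cast; ring
  rw [this, Complex.norm_exp_ofReal_mul_I]

lemma doubleChar_add (k l m n : ℤ) (α β : ℝ) :
    doubleChar (k + l) (m + n) α β = doubleChar k m α β * doubleChar l n α β := by
  unfold doubleChar
  rw [← Complex.exp_add]; congr 1; push_cast; ring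

@[simp] lemma doubleChar_zero (α β : ℝ) : doubleChar 0 0 α β = 1 := by simp [doubleChar]

section Weight

variable {ω δ : ℝ}

lemma one_le_wienerWeight (hω : 0 ≤ ω) (hδ : 0 ≤ δ) (k m : ℤ) : 1 ≤ wienerWeight ω δ k m := by
  unfold wienerWeight
  have h1 : 1 ≤ Real.exp (ω * |(k : ℝ)|) := Real.one_le_exp (by positivity)
  have h2 : 1 ≤ 1 + δ * (|(k : ℝ)| + |(m : ℝ)|) := by
    have : 0 ≤ δ * (|(k : ℝ)| + |(m : ℝ)|) := by positivity
    linarith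
  exact one_le_mul_of_one_le_of_one_le h1 h2

lemma wienerWeight_add_le (hω : 0 ≤ ω) (hδ : 0 ≤ δ) (k l m n : ℤ) :
    wienerWeight ω δ (k + l) (m + n) ≤ wienerWeight ω δ k m * wienerWeight ω δ l n := by
  unfold wienerWeight
  have hk : |((k + l : ℤ) : ℝ)| ≤ |(k : ℝ)| + |(l : ℝ)| := by push_cast; exact abs_add_le _ _
  have hm : |((m + n : ℤ) : ℝ)| ≤ |(m : ℝ)| + |(n : ℝ)| := by push_cast; exact abs_add_le _ _
  have h1 : Real.exp (ω * |((k + l : ℤ) : ℝ)|) ≤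
      Real.exp (ω * |(k : ℝ)|) * Real.exp (ω * |(l : ℝ)|) := by
    rw [← Real.exp_add, ← mul_add]; gcongr
  have h2 : 1 + δ * (|((k + l : ℤ) : ℝ)| + |((m + n : ℤ) : ℝ)|) ≤
      (1 + δ * (|(k : ℝ)| + |(m : ℝ)|)) * (1 + δ * (|(l : ℝ)| + |(n : ℝ)|)) := by
    have h3 : 0 ≤ δ * (|(k : ℝ)| + |(m : ℝ)|) * (δ * (|(l : ℝ)| + |(n : ℝ)|)) := by positivity
    have h4 : δ * (|((k + l : ℤ) : ℝ)| + |((m + n : ℤ) : ℝ)|) ≤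
        δ * (|(k : ℝ)| + |(l : ℝ)| + (|(m : ℝ)| + |(n : ℝ)|)) := by gcongr
    nlinarith
  calc _ ≤ (Real.exp (ω * |(k : ℝ)|) * Real.exp (ω * |(l : ℝ)|)) *
        ((1 + δ * (|(k : ℝ)| + |(m : ℝ)|)) * (1 + δ * (|(l : ℝ)| + |(n : ℝ)|))) := by
          gcongr
    _ = _ := by ring

lemma summable_of_tsum_ofReal_le {ι : Type*} {u : ι → ℝ} (hu : ∀ i, 0 ≤ u i) {c : ℝ}
    (h : ∑' i, ENNReal.ofReal (u i) ≤ ENNReal.ofReal c) : Summable u := by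
  have h1 : ∑' i, ENNReal.ofReal (u i) ≠ ⊤ := ne_top_of_le_ne_top ENNReal.ofReal_ne_top h
  have h2 := ENNReal.summable_toReal h1
  exact h2.congr fun i => ENNReal.toReal_ofReal (hu i)

lemma summable_weight_mul_norm (hω : 0 ≤ ω) (hδ : 0 ≤ δ) {ι : Type*} {a : ι → ℂ} {k m : ι → ℤ}
    {c : ℝ}
    (h : ∑' i, ENNReal.ofReal (wienerWeight ω δ (k i) (m i) * ‖a i‖) ≤ ENNReal.ofReal c) :
    Summable fun i => wienerWeight ω δ (k i) (m i) * ‖a i‖ :=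
  summable_of_tsum_ofReal_le (fun _ => mul_nonneg
    (zero_le_one.trans (one_le_wienerWeight hω hδ _ _)) (norm_nonneg _)) h

lemma summable_norm_of_weight (hω : 0 ≤ ω) (hδ : 0 ≤ δ) {ι : Type*} {a : ι → ℂ} {k m : ι → ℤ}
    {c : ℝ}
    (h : ∑' i, ENNReal.ofReal (wienerWeight ω δ (k i) (m i) * ‖a i‖) ≤ ENNReal.ofReal c) :
    Summable fun i => ‖a i‖ :=
  (summable_weight_mul_norm hω hδ h).of_nonneg_of_le (fun _ => norm_nonneg _) fun _ =>
    le_mul_of_one_le_left (norm_nonneg _) (one_le_wienerWeight hω hδ _ _)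

lemma IsWiener.mono {G : ℝ → ℝ → ℂ} {c d : ℝ} (h : IsWiener ω δ G c) (hcd : c ≤ d) :
    IsWiener ω δ G d := by
  obtain ⟨ι, hι, a, k, m, h1, h2⟩ := h
  exact ⟨ι, hι, a, k, m, h1.trans (ENNReal.ofReal_le_ofReal hcd), h2⟩

lemma IsWiener.monomial (z : ℂ) (k m : ℤ) :
    IsWiener ω δ (fun α β => z * doubleChar k m α β) (wienerWeight ω δ k m * ‖z‖) :=
  ⟨Unit, inferInstance, fun _ => z, fun _ => k, fun _ => m, by simp,
    fun α β => by simp⟩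

lemma IsWiener.const (z : ℂ) : IsWiener ω δ (fun _ _ => z) ‖z‖ := by
  simpa [wienerWeight] using IsWiener.monomial (ω := ω) (δ := δ) z 0 0

lemma IsWiener.mul (hω : 0 ≤ ω) (hδ : 0 ≤ δ) {G H : ℝ → ℝ → ℂ} {c d : ℝ} (hc : 0 ≤ c)
    (hG : IsWiener ω δ G c) (hH : IsWiener ω δ H d) :
    IsWiener ω δ (fun α β => G α β * H α β) (c * d) := by
  obtain ⟨ι, hι, a, k, m, h1, h2⟩ := hG
  obtain ⟨κ, hκ, b, l, n, h3, h4⟩ := hH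
  have ha := summable_norm_of_weight hω hδ h1
  have hb := summable_norm_of_weight hω hδ h3
  refine ⟨ι × κ, inferInstance, fun p => a p.1 * b p.2, fun p => k p.1 + l p.2,
    fun p => m p.1 + n p.2, ?_, fun α β => ?_⟩
  · calc _ ≤ ∑' p : ι × κ, ENNReal.ofReal (wienerWeight ω δ (k p.1) (m p.1) * ‖a p.1‖) *
          ENNReal.ofReal (wienerWeight ω δ (l p.2) (n p.2) * ‖b p.2‖) := by
          refine ENNReal.tsum_le_tsum fun p => ?_
          have h5 := one_le_wienerWeight hω hδ (k p.1) (m p.1)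
          rw [← ENNReal.ofReal_mul (by positivity)]
          refine ENNReal.ofReal_le_ofReal ?_
          rw [norm_mul]
          calc _ ≤ (wienerWeight ω δ (k p.1) (m p.1) * wienerWeight ω δ (l p.2) (n p.2)) *
                (‖a p.1‖ * ‖b p.2‖) := by
                gcongr; exact wienerWeight_add_le hω hδ _ _ _ _
            _ = _ := by ring
      _ = (∑' i, ENNReal.ofReal (wienerWeight ω δ (k i) (m i) * ‖a i‖)) *
          ∑' j, ENNReal.ofReal (wienerWeight ω δ (l j) (n j) * ‖b j‖) := by
          rw [ENNReal.tsum_prod']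
          simp_rw [ENNReal.tsum_mul_left, ENNReal.tsum_mul_right]
      _ ≤ _ := by rw [ENNReal.ofReal_mul hc]; gcongr
  · have h5 : Summable fun p : ι × κ => (a p.1 * doubleChar (k p.1) (m p.1) α β) *
        (b p.2 * doubleChar (l p.2) (n p.2) α β) :=
      summable_mul_of_summable_norm (f := fun i => a i * doubleChar (k i) (m i) α β)
        (g := fun j => b j * doubleChar (l j) (n j) α β)
        (by simpa [norm_doubleChar] using ha) (by simpa [norm_doubleChar] using hb)
    convert! (h2 α β).mul (h4 α β) h5 using 2 with p
    rw [doubleChar_add]; ring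

lemma IsWiener.hasSum (hω : 0 ≤ ω) (hδ : 0 ≤ δ) {ι : Type} [Countable ι] {G : ι → ℝ → ℝ → ℂ}
    {u : ι → ℝ} {c : ℝ} (hG : ∀ i, IsWiener ω δ (G i) (u i))
    (hu : ∑' i, ENNReal.ofReal (u i) ≤ ENNReal.ofReal c) :
    ∃ H : ℝ → ℝ → ℂ, IsWiener ω δ H c ∧ ∀ α β, HasSum (fun i => G i α β) (H α β) := by
  choose κ hκ a k m h1 h2 using hG
  have h3 : ∑' p : Σ i, κ i, ENNReal.ofReal
      (wienerWeight ω δ (k p.1 p.2) (m p.1 p.2) * ‖a p.1 p.2‖) ≤ ENNReal.ofReal c := by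
    rw [ENNReal.tsum_sigma']
    exact (ENNReal.tsum_le_tsum h1).trans hu
  have h4 (α β : ℝ) : Summable fun p : Σ i, κ i =>
      a p.1 p.2 * doubleChar (k p.1 p.2) (m p.1 p.2) α β := by
    refine Summable.of_norm ?_
    simpa [norm_doubleChar] using
      summable_norm_of_weight (k := fun p : Σ i, κ i => k p.1 p.2)
        (m := fun p : Σ i, κ i => m p.1 p.2) hω hδ h3
  exact ⟨fun α β => ∑' p : Σ i, κ i, a p.1 p.2 * doubleChar (k p.1 p.2) (m p.1 p.2) α β,
    ⟨Σ i, κ i, inferInstance, fun p => a p.1 p.2, fun p => k p.1 p.2, fun p => m p.1 p.2, h3,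
      fun α β => (h4 α β).hasSum⟩, fun α β => (h4 α β).hasSum.sigma fun i => h2 i α β⟩

lemma IsWiener.add (hω : 0 ≤ ω) (hδ : 0 ≤ δ) {G H : ℝ → ℝ → ℂ} {c d : ℝ} (hc : 0 ≤ c)
    (hd : 0 ≤ d) (hG : IsWiener ω δ G c) (hH : IsWiener ω δ H d) :
    IsWiener ω δ (fun α β => G α β + H α β) (c + d) := by
  obtain ⟨K, h1, h2⟩ := IsWiener.hasSum (ι := Bool) (G := fun b => cond b G H)
    (u := fun b => cond b c d) (c := c + d) hω hδ (by rintro (_ | _) <;> assumption)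
    (by simp [ENNReal.ofReal_add hc hd])
  convert h1 using 3 with α β
  refine (hasSum_fintype _).unique (h2 α β) |>.symm ▸ ?_
  simp

lemma IsWiener.pow (hω : 0 ≤ ω) (hδ : 0 ≤ δ) {G : ℝ → ℝ → ℂ} {c : ℝ} (hc : 0 ≤ c)
    (hG : IsWiener ω δ G c) (n : ℕ) : IsWiener ω δ (fun α β => G α β ^ n) (c ^ n) := by
  induction n with
  | zero => simpa using IsWiener.const (ω := ω) (δ := δ) 1
  | succ n ih => simpa only [pow_succ] using ih.mul hω hδ (by positivity) hG

lemma IsWiener.exists_inverse (hω : 0 ≤ ω) (hδ : 0 ≤ δ) {G : ℝ → ℝ → ℂ}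
    (hG : IsWiener ω δ G (1 / 2)) :
    ∃ P, IsWiener ω δ P 2 ∧ ∀ α β, P α β * (1 + G α β) = 1 := by
  obtain ⟨P, h1, h2⟩ := IsWiener.hasSum (G := fun n α β => (-1) ^ n * G α β ^ n)
    (u := fun n => (1 / 2) ^ n) (c := 2) hω hδ
    (fun n => by
      have := ((IsWiener.const ((-1 : ℂ) ^ n)).mul hω hδ (norm_nonneg _)
        (hG.pow hω hδ (by norm_num) n))
      simpa using this)
    (by
      rw [← ENNReal.ofReal_tsum_of_nonneg (fun n => by positivity) summable_geometric_two,
        tsum_geometric_two])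
  refine ⟨P, h1, fun α β => ?_⟩
  have h3 : HasSum (fun n : ℕ => (-1) ^ (n + 1) * G α β ^ (n + 1)) (P α β - 1) := by
    simpa using (hasSum_nat_add_iff' 1).mpr (h2 α β)
  have h4 : HasSum (fun n : ℕ => (-1) ^ (n + 1) * G α β ^ (n + 1)) (P α β * -G α β) := by
    convert! (h2 α β).mul_right (-G α β) using 2 with n
    ring
  linear_combination h3.unique h4

end Weight

/-! ### Principal values against `1 / (1 - e^{-iβ})` -/

lemma continuous_doubleChar (k m : ℤ) (α : ℝ) : Continuous fun β => doubleChar k m α β := by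
  unfold doubleChar; fun_prop

lemma continuous_doubleChar_left (k m : ℤ) (β : ℝ) : Continuous fun α => doubleChar k m α β := by
  unfold doubleChar; fun_prop

lemma doubleChar_eq_mul (k m : ℤ) (α β : ℝ) :
    doubleChar k m α β = doubleChar k 0 α 0 * doubleChar 0 m 0 β := by
  unfold doubleChar
  rw [← Complex.exp_add]; congr 1; push_cast; ring

lemma one_sub_doubleChar (α β : ℝ) :
    1 - doubleChar 0 1 α β =
      2 * Complex.I * (Real.sin (β / 2) : ℂ) * Complex.exp (-Complex.I * (β / 2 : ℝ)) := by
  have h1 : doubleChar 0 1 α β =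
      Complex.exp (-Complex.I * (β / 2 : ℝ)) * Complex.exp (-Complex.I * (β / 2 : ℝ)) := by
    rw [← Complex.exp_add]; unfold doubleChar; congr 1; push_cast; ring
  have h2 : Complex.exp (((β / 2 : ℝ) : ℂ) * Complex.I) *
      Complex.exp (-Complex.I * (β / 2 : ℝ)) = 1 := by
    rw [← Complex.exp_add, ← Complex.exp_zero]; congr 1; ring
  have h3 : Complex.exp (-((β / 2 : ℝ) : ℂ) * Complex.I) =
      Complex.exp (-Complex.I * (β / 2 : ℝ)) := by congr 1; ring
  rw [h1, Complex.ofReal_sin, Complex.sin, h3]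
  linear_combination (-1 : ℂ) * h2 + (Complex.exp (((β / 2 : ℝ) : ℂ) * Complex.I) *
    Complex.exp (-Complex.I * (β / 2 : ℝ)) -
      Complex.exp (-Complex.I * (β / 2 : ℝ)) ^ 2) * Complex.I_sq

lemma sin_half_ne_zero {β : ℝ} (h0 : β ≠ 0) (h1 : |β| ≤ Real.pi) : Real.sin (β / 2) ≠ 0 := by
  have hpi := Real.pi_pos
  rw [abs_le] at h1
  rcases lt_or_gt_of_ne h0 with h | h
  · exact (Real.sin_neg_of_neg_of_neg_pi_lt (by linarith) (by linarith)).ne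
  · exact (Real.sin_pos_of_pos_of_lt_pi (by linarith) (by linarith)).ne'

lemma one_sub_doubleChar_ne_zero (α : ℝ) {β : ℝ} (h : Real.sin (β / 2) ≠ 0) :
    1 - doubleChar 0 1 α β ≠ 0 := by
  rw [one_sub_doubleChar]
  exact mul_ne_zero (mul_ne_zero (by simp) (by exact_mod_cast h)) (Complex.exp_ne_zero _)

/-- The integral of `φ` over `ε < |β| < π`. -/
noncomputable def truncIntegral (φ : ℝ → ℂ) (ε : ℝ) : ℂ :=
  (∫ β in ε..Real.pi, φ β) + ∫ β in (-Real.pi)..(-ε), φ β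

lemma sin_half_ne_zero_of_mem_uIcc {ε β : ℝ} (h0 : 0 < ε) (h1 : ε ≤ Real.pi)
    (hβ : β ∈ Set.uIcc ε Real.pi ∨ β ∈ Set.uIcc (-Real.pi) (-ε)) : Real.sin (β / 2) ≠ 0 := by
  rw [Set.uIcc_of_le h1, Set.uIcc_of_le (by linarith), Set.mem_Icc, Set.mem_Icc] at hβ
  refine sin_half_ne_zero ?_ ?_
  · rcases hβ with h | h
    · exact (by linarith : 0 < β).ne'
    · exact (by linarith : β < 0).ne
  · rw [abs_le]; rcases hβ with h | h <;> constructor <;> linarith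

lemma continuousOn_inv_one_sub_doubleChar {ε : ℝ} (h0 : 0 < ε) (h1 : ε ≤ Real.pi) (α : ℝ) :
    ContinuousOn (fun β => (1 - doubleChar 0 1 α β)⁻¹) (Set.uIcc ε Real.pi) ∧
    ContinuousOn (fun β => (1 - doubleChar 0 1 α β)⁻¹) (Set.uIcc (-Real.pi) (-ε)) :=
  ⟨((continuous_const.sub (continuous_doubleChar 0 1 α)).continuousOn).inv₀ fun _ hβ =>
      one_sub_doubleChar_ne_zero α (sin_half_ne_zero_of_mem_uIcc h0 h1 (Or.inl hβ)),
    ((continuous_const.sub (continuous_doubleChar 0 1 α)).continuousOn).inv₀ fun _ hβ =>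
      one_sub_doubleChar_ne_zero α (sin_half_ne_zero_of_mem_uIcc h0 h1 (Or.inr hβ))⟩

lemma tendsto_truncIntegral {φ : ℝ → ℂ} (hφ : Continuous φ) :
    Tendsto (truncIntegral φ) (nhdsWithin 0 (Set.Ioi 0))
      (nhds (∫ β in (-Real.pi)..Real.pi, φ β)) := by
  have hφi (a b : ℝ) : IntervalIntegrable φ volume a b := hφ.intervalIntegrable a b
  have hc : Continuous fun ε : ℝ => ∫ β in (0 : ℝ)..ε, φ β :=
    intervalIntegral.continuous_primitive hφi 0
  have heq : truncIntegral φ = fun ε => (∫ β in (-Real.pi)..Real.pi, φ β) -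
      (∫ β in (0 : ℝ)..ε, φ β) + ∫ β in (0 : ℝ)..(-ε), φ β := by
    funext ε
    unfold truncIntegral
    rw [← intervalIntegral.integral_interval_sub_left (hφi 0 Real.pi) (hφi 0 ε),
      ← intervalIntegral.integral_interval_sub_left (hφi 0 (-ε)) (hφi 0 (-Real.pi)),
      ← intervalIntegral.integral_interval_sub_left (hφi 0 Real.pi) (hφi 0 (-Real.pi))]
    ring
  have hcont : Continuous (truncIntegral φ) := by
    rw [heq]
    exact (continuous_const.sub hc).add (hc.comp continuous_neg)
  have h0 : truncIntegral φ 0 = ∫ β in (-Real.pi)..Real.pi, φ β := by rw [heq]; simp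
  rw [← h0]
  exact (hcont.tendsto 0).mono_left nhdsWithin_le_nhds

/-- The truncated principal value of `e^{-imβ} / (1 - e^{-iβ})`. -/
noncomputable def truncCoef (ε : ℝ) (m : ℤ) : ℂ :=
  (1 / (2 * Real.pi)) *
    truncIntegral (fun β => doubleChar 0 m 0 β * (1 - doubleChar 0 1 0 β)⁻¹) ε

/-- The principal value of `e^{-imβ} / (1 - e^{-iβ})`. -/
noncomputable def pvCoef (m : ℤ) : ℂ := if m ≤ 0 then 1 / 2 else -1 / 2

lemma norm_pvCoef (m : ℤ) : ‖pvCoef m‖ = 1 / 2 := by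
  unfold pvCoef; split_ifs <;> norm_num

lemma truncCoef_zero {ε : ℝ} (h0 : 0 < ε) (h1 : ε ≤ Real.pi) :
    truncCoef ε 0 = (1 / (2 * Real.pi)) * (Real.pi - ε) := by
  obtain ⟨hc1, hc2⟩ := continuousOn_inv_one_sub_doubleChar h0 h1 0
  have hneg : (∫ β in (-Real.pi)..(-ε), (1 - doubleChar 0 1 0 β)⁻¹) =
      ∫ β in ε..Real.pi, (1 - doubleChar 0 1 0 (-β))⁻¹ := by
    rw [intervalIntegral.integral_comp_neg (fun β => (1 - doubleChar 0 1 0 β)⁻¹)]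
  have hc3 : ContinuousOn (fun β => (1 - doubleChar 0 1 0 (-β))⁻¹) (Set.uIcc ε Real.pi) := by
    refine hc2.comp continuous_neg.continuousOn fun β hβ => ?_
    rw [Set.uIcc_of_le h1, Set.mem_Icc] at hβ
    rw [Set.uIcc_of_le (by linarith), Set.mem_Icc]
    constructor <;> linarith
  unfold truncCoef truncIntegral
  simp only [doubleChar_zero, one_mul]
  rw [hneg, ← intervalIntegral.integral_add hc1.intervalIntegrable hc3.intervalIntegrable]
  congr 1
  rw [intervalIntegral.integral_congr (g := fun _ => (1 : ℂ))]
  · simp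
  · intro β hβ
    have hs := sin_half_ne_zero_of_mem_uIcc h0 h1 (Or.inl hβ)
    have hn1 := one_sub_doubleChar_ne_zero 0 hs
    have hn2 := one_sub_doubleChar_ne_zero 0 (β := -β) (by
      rw [neg_div, Real.sin_neg]; exact neg_ne_zero.mpr hs)
    have hmul : doubleChar 0 1 0 β * doubleChar 0 1 0 (-β) = 1 := by
      unfold doubleChar
      rw [← Complex.exp_add, ← Complex.exp_zero]; congr 1; push_cast; ring
    simp only
    field_simp
    linear_combination -hmul

lemma truncCoef_succ {ε : ℝ} (h0 : 0 < ε) (h1 : ε ≤ Real.pi) (m : ℤ) :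
    truncCoef ε m - truncCoef ε (m + 1) =
      (1 / (2 * Real.pi)) * truncIntegral (fun β => doubleChar 0 m 0 β) ε := by
  obtain ⟨hc1, hc2⟩ := continuousOn_inv_one_sub_doubleChar h0 h1 0
  have hi1 (n : ℤ) : IntervalIntegrable
      (fun β => doubleChar 0 n 0 β * (1 - doubleChar 0 1 0 β)⁻¹) volume ε Real.pi :=
    (((continuous_doubleChar 0 n 0).continuousOn).mul hc1).intervalIntegrable
  have hi2 (n : ℤ) : IntervalIntegrable
      (fun β => doubleChar 0 n 0 β * (1 - doubleChar 0 1 0 β)⁻¹) volume (-Real.pi) (-ε) :=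
    (((continuous_doubleChar 0 n 0).continuousOn).mul hc2).intervalIntegrable
  unfold truncCoef truncIntegral
  rw [← mul_sub, add_sub_add_comm, ← intervalIntegral.integral_sub (hi1 m) (hi1 (m + 1)),
    ← intervalIntegral.integral_sub (hi2 m) (hi2 (m + 1))]
  have key {β : ℝ} (hs : Real.sin (β / 2) ≠ 0) :
      doubleChar 0 m 0 β * (1 - doubleChar 0 1 0 β)⁻¹ -
        doubleChar 0 (m + 1) 0 β * (1 - doubleChar 0 1 0 β)⁻¹ = doubleChar 0 m 0 β := by
    have hadd := doubleChar_add 0 0 m 1 0 β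
    rw [add_zero] at hadd
    rw [hadd]
    have := one_sub_doubleChar_ne_zero 0 hs
    field_simp
  congr 2
  · exact intervalIntegral.integral_congr fun β hβ =>
      key (sin_half_ne_zero_of_mem_uIcc h0 h1 (Or.inl hβ))
  · exact intervalIntegral.integral_congr fun β hβ =>
      key (sin_half_ne_zero_of_mem_uIcc h0 h1 (Or.inr hβ))

lemma norm_one_div_two_pi : ‖(1 / (2 * Real.pi) : ℂ)‖ = 1 / (2 * Real.pi) := by
  have : (1 / (2 * Real.pi) : ℂ) = ((1 / (2 * Real.pi) : ℝ) : ℂ) := by push_cast; ring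
  rw [this, Complex.norm_real, Real.norm_of_nonneg (by have := Real.pi_pos; positivity)]

lemma norm_truncCoef_sub_le {ε : ℝ} (h0 : 0 < ε) (h1 : ε ≤ Real.pi) (m : ℤ) :
    ‖truncCoef ε m - truncCoef ε (m + 1)‖ ≤ 1 := by
  have hpi := Real.pi_pos
  rw [truncCoef_succ h0 h1, norm_mul, norm_one_div_two_pi]
  have hb (a b : ℝ) : ‖∫ β in a..b, doubleChar 0 m 0 β‖ ≤ 1 * |b - a| :=
    intervalIntegral.norm_integral_le_of_norm_le_const fun β _ => (norm_doubleChar 0 m 0 β).le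
  have h2 : ‖truncIntegral (fun β => doubleChar 0 m 0 β) ε‖ ≤ 2 * Real.pi := by
    have e1 := hb ε Real.pi
    have e2 := hb (-Real.pi) (-ε)
    rw [abs_of_nonneg (by linarith)] at e1 e2
    exact (norm_add_le _ _).trans (by linarith)
  calc _ ≤ 1 / (2 * Real.pi) * (2 * Real.pi) := by gcongr
    _ = 1 := by field_simp

lemma norm_truncCoef_le {ε : ℝ} (h0 : 0 < ε) (h1 : ε ≤ Real.pi) (m : ℤ) :
    ‖truncCoef ε m‖ ≤ 1 + |(m : ℝ)| := by
  have hpi := Real.pi_pos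
  induction m using Int.induction_on with
  | zero =>
    rw [truncCoef_zero h0 h1, norm_mul, norm_one_div_two_pi, ← Complex.ofReal_sub,
      Complex.norm_real, Real.norm_of_nonneg (by linarith), one_div, ← div_eq_inv_mul,
      div_le_iff₀ (by positivity)]
    simp only [Int.cast_zero, abs_zero]
    linarith
  | succ n ih =>
    have h2 := norm_truncCoef_sub_le h0 h1 n
    rw [norm_sub_rev] at h2
    have h3 := norm_sub_norm_le (truncCoef ε (n + 1)) (truncCoef ε n)
    push_cast at ih ⊢
    rw [abs_of_nonneg (by positivity)] at ih ⊢
    linarith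
  | pred n ih =>
    have h2 := norm_truncCoef_sub_le h0 h1 (-n - 1)
    have h3 := norm_sub_norm_le (truncCoef ε (-n - 1)) (truncCoef ε (-n))
    rw [sub_add_cancel] at h2
    have h4 : |(((-n - 1 : ℤ)) : ℝ)| = n + 1 := by
      push_cast; rw [← abs_neg, abs_of_nonneg (by linarith [n.cast_nonneg (α := ℝ)])]; ring
    have h5 : |(((-n : ℤ)) : ℝ)| = n := by push_cast; rw [abs_neg, Nat.abs_cast]
    rw [h4]; rw [h5] at ih
    linarith

lemma integral_doubleChar (k : ℤ) :
    (1 / (2 * Real.pi) : ℂ) * ∫ α in (-Real.pi)..Real.pi, doubleChar k 0 α 0 =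
      if k = 0 then 1 else 0 := by
  have hpi : (Real.pi : ℂ) ≠ 0 := by exact_mod_cast Real.pi_ne_zero
  split_ifs with hk
  · subst hk
    simp only [doubleChar_zero, intervalIntegral.integral_const]
    simp only [Complex.real_smul]
    push_cast
    field_simp
    ring
  · have hk' : Complex.I * (k : ℂ) ≠ 0 := mul_ne_zero Complex.I_ne_zero (by exact_mod_cast hk)
    have h1 : (fun α : ℝ => doubleChar k 0 α 0) =
        fun α : ℝ => Complex.exp (Complex.I * k * α) := by
      funext α; unfold doubleChar; congr 1; push_cast; ring
    rw [h1, integral_exp_mul_complex hk']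
    have h2 : Complex.exp (Complex.I * k * (Real.pi : ℝ)) =
        Complex.exp (Complex.I * k * (-Real.pi : ℝ)) := by
      rw [Complex.exp_eq_exp_iff_exists_int]
      exact ⟨k, by push_cast; ring⟩
    rw [h2, sub_self, zero_div, mul_zero]

lemma doubleChar_zero_left (m : ℤ) (α β : ℝ) : doubleChar 0 m α β = doubleChar (-m) 0 β 0 := by
  unfold doubleChar; congr 1; push_cast; ring

lemma pvCoef_succ (m : ℤ) : pvCoef m - pvCoef (m + 1) = if m = 0 then 1 else 0 := by
  unfold pvCoef
  split_ifs <;> first | omega | norm_num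

lemma tendsto_truncCoef (m : ℤ) :
    Tendsto (fun ε => truncCoef ε m) (nhdsWithin 0 (Set.Ioi 0)) (nhds (pvCoef m)) := by
  have hpi := Real.pi_pos
  have hpi' : (Real.pi : ℂ) ≠ 0 := by exact_mod_cast Real.pi_ne_zero
  have hev : ∀ᶠ ε : ℝ in nhdsWithin 0 (Set.Ioi 0), 0 < ε ∧ ε ≤ Real.pi := by
    filter_upwards [Ioc_mem_nhdsGT hpi] with ε hε using hε
  have hdiff (n : ℤ) : Tendsto (fun ε => truncCoef ε n - truncCoef ε (n + 1))
      (nhdsWithin 0 (Set.Ioi 0)) (nhds (pvCoef n - pvCoef (n + 1))) := by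
    have h1 := (tendsto_truncIntegral (continuous_doubleChar 0 n 0)).const_mul
      (1 / (2 * Real.pi) : ℂ)
    simp_rw [doubleChar_zero_left n 0] at h1
    simp only [integral_doubleChar, neg_eq_zero, ← pvCoef_succ] at h1
    refine h1.congr' ?_
    filter_upwards [hev] with ε hε
    rw [truncCoef_succ hε.1 hε.2]
    simp_rw [doubleChar_zero_left n 0]
  induction m using Int.induction_on with
  | zero =>
    have h1 : Tendsto (fun ε : ℝ => (1 / (2 * Real.pi) : ℂ) * (Real.pi - ε))
        (nhdsWithin 0 (Set.Ioi 0)) (nhds (pvCoef 0)) := by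
      have hc : Continuous fun ε : ℝ => (1 / (2 * Real.pi) : ℂ) * (Real.pi - ε) := by fun_prop
      have := (hc.tendsto 0).mono_left (nhdsWithin_le_nhds (s := Set.Ioi 0))
      have h2 : (1 / (2 * Real.pi) : ℂ) * (Real.pi - (0 : ℝ)) = pvCoef 0 := by
        simp only [pvCoef, le_refl, if_true, Complex.ofReal_zero, sub_zero]
        field_simp
      rwa [h2] at this
    refine h1.congr' ?_
    filter_upwards [hev] with ε hε using (truncCoef_zero hε.1 hε.2).symm
  | succ n ih => simpa using ih.sub (hdiff n)
  | pred n ih =>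
    have := ih.add (hdiff (-n - 1))
    simp only [sub_add_cancel, add_sub_cancel] at this
    exact this
lemma hasSum_intervalIntegral_mul {ι : Type} [Countable ι] {a : ι → ℂ}
    (ha : Summable fun i => ‖a i‖) {e : ι → ℝ → ℂ} (he : ∀ i, Continuous (e i))
    (hn : ∀ i x, ‖e i x‖ = 1) {G v : ℝ → ℂ} (hG : ∀ x, HasSum (fun i => a i * e i x) (G x))
    {x y : ℝ} (hv : ContinuousOn v (Set.uIcc x y)) :
    HasSum (fun i => ∫ t in x..y, a i * e i t * v t) (∫ t in x..y, G t * v t) := by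
  have hm (i : ι) : ContinuousOn (fun t => a i * e i t * v t) (Set.uIcc x y) :=
    (continuous_const.mul (he i)).continuousOn.mul hv
  refine intervalIntegral.hasSum_integral_of_dominated_convergence
    (fun i t => ‖a i‖ * ‖v t‖) (fun i => ?_) (fun i => ?_) ?_ ?_ ?_
  · exact ((hm i).mono Set.uIoc_subset_uIcc).aestronglyMeasurable measurableSet_uIoc
  · exact Eventually.of_forall fun t _ => by rw [norm_mul, norm_mul, hn, mul_one]
  · exact Eventually.of_forall fun t _ => ha.mul_right _
  · simp_rw [tsum_mul_right]
    exact (continuousOn_const.mul hv.norm).intervalIntegrable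
  · exact Eventually.of_forall fun t _ => (hG t).mul_right _

section PrincipalValue

variable {ω δ : ℝ}

lemma exists_principalValue (hω : 0 ≤ ω) (hδ : 0 < δ) {G : ℝ → ℝ → ℂ} {c : ℝ}
    (hG : IsWiener ω δ G c) :
    ∃ (ι : Type) (_ : Countable ι) (b : ι → ℂ) (k : ι → ℤ) (V : ℝ → ℂ),
      ∑' i, ENNReal.ofReal (wienerWeight ω δ (k i) 0 * ‖b i‖) ≤ ENNReal.ofReal (c / 2) ∧
      (∀ α, HasSum (fun i => b i * doubleChar (k i) 0 α 0) (V α)) ∧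
      ∀ α, Tendsto (fun ε => (1 / (2 * Real.pi) : ℂ) *
          truncIntegral (fun β => G α β * (1 - doubleChar 0 1 0 β)⁻¹) ε)
        (nhdsWithin 0 (Set.Ioi 0)) (nhds (V α)) := by
  obtain ⟨ι, hι, a, k, m, h1, h2⟩ := hG
  have ha := summable_norm_of_weight hω hδ.le h1
  have haw := summable_weight_mul_norm hω hδ.le h1
  have hb : Summable fun i => ‖a i * pvCoef (m i)‖ := by
    simp_rw [norm_mul, norm_pvCoef]; exact ha.mul_right _
  refine ⟨ι, hι, fun i => a i * pvCoef (m i), k,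
    fun α => ∑' i, a i * pvCoef (m i) * doubleChar (k i) 0 α 0, ?_, fun α => ?_, fun α => ?_⟩
  · rw [div_eq_mul_one_div, mul_comm c, ENNReal.ofReal_mul (by norm_num)]
    refine le_trans ?_ (mul_le_mul_right h1 _)
    rw [← ENNReal.tsum_mul_left]
    refine ENNReal.tsum_le_tsum fun i => ?_
    rw [← ENNReal.ofReal_mul (by norm_num), norm_mul, norm_pvCoef]
    refine ENNReal.ofReal_le_ofReal ?_
    have hw : wienerWeight ω δ (k i) 0 ≤ wienerWeight ω δ (k i) (m i) := by
      have hm : |((0 : ℤ) : ℝ)| ≤ |(m i : ℝ)| := by simp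
      unfold wienerWeight; gcongr
    nlinarith [mul_le_mul_of_nonneg_right hw (norm_nonneg (a i))]
  · exact (Summable.of_norm (by simpa [norm_doubleChar] using hb)).hasSum
  · have hbound : Summable fun i => ‖a i‖ * (1 + |(m i : ℝ)|) := by
      refine (haw.mul_left (1 + δ⁻¹)).of_nonneg_of_le (fun i => by positivity) fun i => ?_
      have hm : 1 + |(m i : ℝ)| ≤ (1 + δ⁻¹) * wienerWeight ω δ (k i) (m i) := by
        have h3 : 1 + δ * |(m i : ℝ)| ≤ wienerWeight ω δ (k i) (m i) := by
          unfold wienerWeight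
          have h4 : 1 ≤ Real.exp (ω * |(k i : ℝ)|) := Real.one_le_exp (by positivity)
          have h5 : 1 + δ * |(m i : ℝ)| ≤ 1 + δ * (|(k i : ℝ)| + |(m i : ℝ)|) := by
            gcongr; linarith [abs_nonneg (k i : ℝ)]
          exact h5.trans (le_mul_of_one_le_left (by positivity) h4)
        have h6 : (1 + δ⁻¹) * (1 + δ * |(m i : ℝ)|) =
            1 + |(m i : ℝ)| + (δ * |(m i : ℝ)| + δ⁻¹) := by
          field_simp; ring
        have h7 : (1 + δ⁻¹) * (1 + δ * |(m i : ℝ)|) ≤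
            (1 + δ⁻¹) * wienerWeight ω δ (k i) (m i) := by gcongr
        have h8 : 0 ≤ δ * |(m i : ℝ)| + δ⁻¹ := by positivity
        linarith
      calc _ ≤ ‖a i‖ * ((1 + δ⁻¹) * wienerWeight ω δ (k i) (m i)) := by gcongr
        _ = _ := by ring
    have hev : ∀ᶠ ε : ℝ in nhdsWithin 0 (Set.Ioi 0), 0 < ε ∧ ε ≤ Real.pi := by
      filter_upwards [Ioc_mem_nhdsGT Real.pi_pos] with ε hε using hε
    have key : Tendsto (fun ε => ∑' i, a i * doubleChar (k i) 0 α 0 * truncCoef ε (m i))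
        (nhdsWithin 0 (Set.Ioi 0))
        (nhds (∑' i, a i * pvCoef (m i) * doubleChar (k i) 0 α 0)) := by
      refine tendsto_tsum_of_dominated_convergence hbound (fun i => ?_) ?_
      · rw [mul_right_comm]
        exact (tendsto_truncCoef (m i)).const_mul _
      · filter_upwards [hev] with ε hε i
        rw [norm_mul, norm_mul, norm_doubleChar, mul_one]
        gcongr
        exact norm_truncCoef_le hε.1 hε.2 _
    refine key.congr' ?_
    filter_upwards [hev] with ε hε
    obtain ⟨hc1, hc2⟩ := continuousOn_inv_one_sub_doubleChar hε.1 hε.2 0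
    have hs1 := hasSum_intervalIntegral_mul ha (fun i => continuous_doubleChar (k i) (m i) α)
      (fun i β => norm_doubleChar _ _ _ _) (h2 α) hc1
    have hs2 := hasSum_intervalIntegral_mul ha (fun i => continuous_doubleChar (k i) (m i) α)
      (fun i β => norm_doubleChar _ _ _ _) (h2 α) hc2
    refine HasSum.tsum_eq ?_
    convert! (hs1.add hs2).mul_left (1 / (2 * Real.pi) : ℂ) using 2 with i
    have hpull (x y : ℝ) : ∫ β in x..y, a i * doubleChar (k i) (m i) α β *
        (1 - doubleChar 0 1 0 β)⁻¹ = a i * doubleChar (k i) 0 α 0 *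
          ∫ β in x..y, doubleChar 0 (m i) 0 β * (1 - doubleChar 0 1 0 β)⁻¹ := by
      rw [← intervalIntegral.integral_const_mul]
      congr 1; funext β
      rw [doubleChar_eq_mul (k i)]; ring
    rw [hpull, hpull]
    unfold truncCoef truncIntegral
    ring

end PrincipalValue

/-! ### Fourier coefficients -/

lemma fourierCoef_eq (u : ℝ → ℝ) (n : ℤ) :
    fourierCoef u n = (1 / (2 * Real.pi)) *
      ∫ α in (-Real.pi)..Real.pi, (u α : ℂ) * doubleChar (-n) 0 α 0 := by
  unfold fourierCoef doubleChar
  congr 2; funext α; congr 2; push_cast; ring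

lemma hasSum_fourierCoef {ι : Type} [Countable ι] {b : ι → ℂ} {k : ι → ℤ} {u : ℝ → ℝ}
    (hb : Summable fun i => ‖b i‖)
    (hu : ∀ α, HasSum (fun i => b i * doubleChar (k i) 0 α 0) (u α : ℂ)) (n : ℤ) :
    HasSum (fun i => if n = k i then b i else 0) (fourierCoef u n) := by
  rw [fourierCoef_eq]
  have h := hasSum_intervalIntegral_mul (x := -Real.pi) (y := Real.pi) hb
    (fun i => continuous_doubleChar_left (k i) 0 0)
    (fun i β => norm_doubleChar _ _ _ _) hu (continuous_doubleChar_left (-n) 0 0).continuousOn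
  convert! h.mul_left (1 / (2 * Real.pi) : ℂ) using 2 with i
  have h1 (α : ℝ) : b i * doubleChar (k i) 0 α 0 * doubleChar (-n) 0 α 0 =
      b i * doubleChar (k i - n) 0 α 0 := by
    rw [mul_assoc, ← doubleChar_add, add_zero, sub_eq_add_neg]
  simp_rw [h1, intervalIntegral.integral_const_mul]
  rw [mul_left_comm, integral_doubleChar]
  simp [sub_eq_zero, eq_comm]

lemma tsum_weight_fourierCoef_le {ι : Type} [Countable ι] {b : ι → ℂ} {k : ι → ℤ} {u : ℝ → ℝ}
    (hb : Summable fun i => ‖b i‖)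
    (hu : ∀ α, HasSum (fun i => b i * doubleChar (k i) 0 α 0) (u α : ℂ)) {w : ℤ → ℝ}
    (hw : ∀ n, 0 ≤ w n) :
    ∑' n, ENNReal.ofReal (w n * ‖fourierCoef u n‖) ≤
      ∑' i, ENNReal.ofReal (w (k i) * ‖b i‖) := by
  have h1 (n : ℤ) : ENNReal.ofReal (w n * ‖fourierCoef u n‖) ≤
      ∑' i, ENNReal.ofReal (w n * ‖if n = k i then b i else 0‖) := by
    have hs := hasSum_fourierCoef hb hu n
    have hs' : Summable fun i => ‖if n = k i then b i else 0‖ := by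
      refine hb.of_nonneg_of_le (fun i => norm_nonneg _) fun i => ?_
      split_ifs <;> simp
    rw [← ENNReal.ofReal_tsum_of_nonneg (fun i => mul_nonneg (hw n) (norm_nonneg _))
      (hs'.mul_left _), tsum_mul_left, ← hs.tsum_eq]
    exact ENNReal.ofReal_le_ofReal
      (mul_le_mul_of_nonneg_left (norm_tsum_le_tsum_norm hs') (hw n))
  refine (ENNReal.tsum_le_tsum h1).trans ?_
  rw [ENNReal.tsum_comm]
  refine ENNReal.tsum_le_tsum fun i => ?_
  rw [tsum_eq_single (k i) fun n hn => by simp [hn]]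
  simp

lemma hasSum_fourierSeries {u : ℝ → ℝ} (hp : Function.Periodic u (2 * Real.pi))
    (hc : Continuous u) (hs : Summable fun n => ‖fourierCoef u n‖) (α : ℝ) :
    HasSum (fun n => fourierCoef u n * doubleChar n 0 α 0) (u α : ℂ) := by
  have : Fact (0 < 2 * Real.pi) := ⟨Real.two_pi_pos⟩
  have hpi : (Real.pi : ℂ) ≠ 0 := by exact_mod_cast Real.pi_ne_zero
  have hp' : Function.Periodic (fun x => (u x : ℂ)) (2 * Real.pi) := fun x => by
    simp only [hp x]
  let U : C(AddCircle (2 * Real.pi), ℂ) :=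
    ⟨hp'.lift, continuous_coinduced_dom.mpr (Complex.continuous_ofReal.comp hc)⟩
  have hchar (n : ℤ) (x : ℝ) : fourier n (x : AddCircle (2 * Real.pi)) = doubleChar n 0 x 0 := by
    rw [fourier_coe_apply]
    unfold doubleChar
    congr 1; push_cast; field_simp; ring
  have hcoef (n : ℤ) : fourierCoeff U n = fourierCoef u n := by
    rw [fourierCoeff_eq_intervalIntegral U n (-Real.pi), fourierCoef_eq,
      show -Real.pi + 2 * Real.pi = Real.pi by ring, Complex.real_smul]
    push_cast
    congr 2; funext x
    rw [hchar, smul_eq_mul, mul_comm]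
    rfl
  have h := has_pointwise_sum_fourier_series_of_summable (f := U)
    (by simpa only [funext hcoef] using Summable.of_norm hs) (α : AddCircle (2 * Real.pi))
  simp only [hcoef, hchar, smul_eq_mul] at h
  exact h

lemma hasSum_deriv_fourierSeries {u : ℝ → ℝ} (hp : Function.Periodic u (2 * Real.pi))
    (hc : Continuous u) (hs : Summable fun n => ‖fourierCoef u n‖)
    (hs1 : Summable fun n : ℤ => |(n : ℝ)| * ‖fourierCoef u n‖) (α : ℝ) :
    HasSum (fun n => fourierCoef u n * (Complex.I * n) * doubleChar n 0 α 0) ((deriv u α : ℝ) : ℂ) := by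
  have hnorm (n : ℤ) (x : ℝ) : ‖fourierCoef u n * (Complex.I * n) * doubleChar n 0 x 0‖ ≤
      |(n : ℝ)| * ‖fourierCoef u n‖ := by
    rw [norm_mul, norm_mul, norm_mul, norm_doubleChar, Complex.norm_I, Complex.norm_intCast]
    exact le_of_eq (by ring)
  have hd (n : ℤ) (x : ℝ) : HasDerivAt (fun y : ℝ => fourierCoef u n * doubleChar n 0 y 0)
      (fourierCoef u n * (Complex.I * n) * doubleChar n 0 x 0) x := by
    have h1 : HasDerivAt (fun y : ℝ => Complex.I * (n * (y : ℂ) - (0 : ℤ) * (0 : ℝ)))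
        (Complex.I * n) x := by
      have := (((Complex.ofRealCLM.hasDerivAt (x := x)).const_mul (n : ℂ)).sub_const
        (((0 : ℤ) : ℂ) * ((0 : ℝ) : ℂ))).const_mul Complex.I
      simpa using this
    have h2 := (h1.cexp).const_mul (fourierCoef u n)
    unfold doubleChar
    convert! h2 using 1
    ring
  have h := hasDerivAt_tsum hs1 hd hnorm (y₀ := 0)
    (hasSum_fourierSeries hp hc hs 0).summable α
  have heq : (fun z : ℝ => ∑' n, fourierCoef u n * doubleChar n 0 z 0) = fun z => (u z : ℂ) :=
    funext fun z => (hasSum_fourierSeries hp hc hs z).tsum_eq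
  rw [heq] at h
  have hre : HasDerivAt u
      (∑' n : ℤ, fourierCoef u n * (Complex.I * n) * doubleChar n 0 α 0).re α := by
    exact Complex.reCLM.hasFDerivAt.comp_hasDerivAt α h
  have hcast : HasDerivAt (fun z => (u z : ℂ)) ((deriv u α : ℝ) : ℂ) α := by
    rw [hre.deriv]; exact hre.ofReal_comp
  rw [hcast.unique h]
  exact (Summable.of_norm (hs1.of_nonneg_of_le (fun _ => norm_nonneg _)
    fun n => hnorm n α)).hasSum
/-! ### Divided differences and the kernel of `D[f]` -/

section Kernel

variable {ω δ : ℝ}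

lemma wienerWeight_mono (hδ : 0 ≤ δ) (k : ℤ) {m n : ℤ} (h : |m| ≤ |n|) :
    wienerWeight ω δ k m ≤ wienerWeight ω δ k n := by
  have h' : |(m : ℝ)| ≤ |(n : ℝ)| := by exact_mod_cast h
  unfold wienerWeight; gcongr

lemma sum_doubleChar_mul_one_sub (k m : ℤ) (n : ℕ) (α β : ℝ) :
    (∑ j ∈ Finset.range n, doubleChar k (m + j) α β) * (1 - doubleChar 0 1 α β) =
      doubleChar k m α β - doubleChar k (m + n) α β := by
  induction n with
  | zero => simp
  | succ n ih =>
    have h : doubleChar k (m + (n + 1 : ℕ)) α β =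
        doubleChar k (m + n) α β * doubleChar 0 1 α β := by
      rw [← doubleChar_add]; congr 1 <;> push_cast <;> ring
    rw [Finset.sum_range_succ, add_mul, ih, h]
    ring

lemma isWiener_sum_doubleChar (hω : 0 ≤ ω) (hδ : 0 ≤ δ) (k m : ℤ) (n : ℕ) (z : ℂ) {p : ℤ}
    (h : ∀ j < n, |m + (j : ℤ)| ≤ |p|) :
    IsWiener ω δ (fun α β => z * ∑ j ∈ Finset.range n, doubleChar k (m + j) α β)
      (n * wienerWeight ω δ k p * ‖z‖) := by
  obtain ⟨H, h1, h2⟩ := IsWiener.hasSum (ι := Fin n)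
    (G := fun j α β => z * doubleChar k (m + (j : ℕ)) α β)
    (u := fun _ => wienerWeight ω δ k p * ‖z‖) (c := n * wienerWeight ω δ k p * ‖z‖) hω hδ
    (fun j => (IsWiener.monomial z k (m + (j : ℕ))).mono
      (mul_le_mul_of_nonneg_right (wienerWeight_mono hδ k (h j j.2)) (norm_nonneg z)))
    (by
      rw [tsum_fintype, Finset.sum_const, Finset.card_univ, Fintype.card_fin, nsmul_eq_mul,
        mul_assoc, ENNReal.ofReal_mul (p := (n : ℝ)) (by positivity), ENNReal.ofReal_natCast])
  convert! h1 using 3 with α β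
  rw [← (h2 α β).tsum_eq, tsum_fintype, Finset.mul_sum, Finset.sum_range]

lemma exists_dividedDifference_doubleChar (hω : 0 ≤ ω) (hδ : 0 ≤ δ) (k : ℤ) :
    ∃ H, IsWiener ω δ H (|(k : ℝ)| * wienerWeight ω δ k k) ∧
      ∀ α β, H α β * (1 - doubleChar 0 1 α β) = doubleChar k k α β - doubleChar k 0 α β := by
  obtain ⟨n, rfl | rfl⟩ := k.eq_nat_or_neg
  · have h := isWiener_sum_doubleChar hω hδ n 0 n (-1) (p := n) fun j hj => by
      rw [abs_of_nonneg (by positivity), abs_of_nonneg (by positivity)]; omega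
    refine ⟨_, h.mono (by simp), fun α β => ?_⟩
    have := sum_doubleChar_mul_one_sub n 0 n α β
    rw [mul_assoc, this, zero_add]; ring
  · have h := isWiener_sum_doubleChar hω hδ (-n) (-n) n 1 (p := -n) fun j hj => by
      rw [abs_of_nonpos (by omega), abs_of_nonpos (by omega)]; omega
    refine ⟨_, h.mono (by simp), fun α β => ?_⟩
    have := sum_doubleChar_mul_one_sub (-n) (-n) n α β
    rw [mul_assoc, this, neg_add_cancel]; ring

lemma IsWiener.continuous {G : ℝ → ℝ → ℂ} {c : ℝ} (hω : 0 ≤ ω) (hδ : 0 ≤ δ)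
    (hG : IsWiener ω δ G c) (α : ℝ) : Continuous (G α) := by
  obtain ⟨ι, hι, a, k, m, h1, h2⟩ := hG
  have h3 : G α = fun β => ∑' i, a i * doubleChar (k i) (m i) α β :=
    funext fun β => (h2 α β).tsum_eq.symm
  rw [h3]
  exact continuous_tsum (fun i => continuous_const.mul (continuous_doubleChar _ _ _))
    (summable_norm_of_weight hω hδ h1) fun i β => by rw [norm_mul, norm_doubleChar, mul_one]

/-- The representation of the kernel of `D[f]` as a small element of the Wiener algebra, up to the
factor `1 / (1 - e^{-iβ})` and the part of the kernel present for `f = 0`. -/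
lemma exists_kernel (hω : 0 ≤ ω) (hδ : 0 ≤ δ) (hδ1 : δ ≤ 1) {e γ : ℝ} (he0 : 0 ≤ e)
    (he : e ≤ 1 / 36) (hγ : 0 ≤ γ) {a b d E h : ℝ → ℝ → ℂ} (ha : IsWiener ω δ a e)
    (hb : IsWiener ω δ b e) (hd : IsWiener ω δ d e) (hE : IsWiener ω δ E e)
    (hh : IsWiener ω δ h γ) :
    ∃ P S : ℝ → ℝ → ℂ, IsWiener ω δ S (9 * e * γ) ∧ ∀ α β,
      P α β * (-doubleChar 0 1 α β * E α β ^ 2 + (1 + a α β) * (1 + b α β)) = 1 ∧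
      S α β = ((1 - doubleChar 0 1 α β) * (1 / 2) * doubleChar 0 1 α β * E α β ^ 2 +
        (-doubleChar 0 1 α β * (1 + a α β) * E α β - Complex.I / 2 *
          (1 + doubleChar 0 1 α β) * (1 + b α β) * d α β)) * h α β * P α β := by
  have hw : IsWiener ω δ (fun α β => doubleChar 0 1 α β) 2 := by
    have := IsWiener.monomial (ω := ω) (δ := δ) 1 0 1
    simp only [one_mul, norm_one, mul_one] at this
    refine this.mono ?_
    simp only [wienerWeight, Int.cast_zero, abs_zero, mul_zero, Real.exp_zero, Int.cast_one,
      abs_one, zero_add, mul_one, one_mul]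
    linarith
  have h1 : IsWiener ω δ (fun _ _ => (1 : ℂ)) 1 := by
    simpa using IsWiener.const (ω := ω) (δ := δ) 1
  have hm1 : IsWiener ω δ (fun _ _ => (-1 : ℂ)) 1 := by
    simpa using IsWiener.const (ω := ω) (δ := δ) (-1)
  have hhalf : IsWiener ω δ (fun _ _ => (1 / 2 : ℂ)) (1 / 2) := by
    simpa using IsWiener.const (ω := ω) (δ := δ) (1 / 2)
  have hI : IsWiener ω δ (fun _ _ => (-(Complex.I / 2) : ℂ)) (1 / 2) := by
    simpa using IsWiener.const (ω := ω) (δ := δ) (-(Complex.I / 2))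
  have hmw := hm1.mul hω hδ zero_le_one hw
  have hE2 := hE.pow hω hδ he0 2
  have hq := (((hmw.mul hω hδ (by positivity) hE2).add hω hδ (by positivity) he0 ha).add hω hδ
    (by positivity) he0 hb).add hω hδ (by positivity) (by positivity) (ha.mul hω hδ he0 hb)
  obtain ⟨P, hP, hP1⟩ := (hq.mono (d := 1 / 2) (by nlinarith)).exists_inverse hω hδ
  have hS1 := (((h1.add hω hδ (by positivity) (by positivity) hmw).mul hω hδ (by positivity)
    hhalf).mul hω hδ (by positivity) hw).mul hω hδ (by positivity) hE2
  have hM1 := (hmw.mul hω hδ (by positivity) (h1.add hω hδ (by positivity) he0 ha)).mul hω hδ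
    (by positivity) hE
  have hM2 := ((hI.mul hω hδ (by positivity) (h1.add hω hδ (by positivity) (by positivity)
    hw)).mul hω hδ (by positivity) (h1.add hω hδ (by positivity) he0 hb)).mul hω hδ
    (by positivity) hd
  have hS := ((hS1.add hω hδ (by positivity) (by positivity) (hM1.add hω hδ (by positivity)
    (by positivity) hM2)).mul hω hδ (by positivity) hh).mul hω hδ (by positivity) hP
  refine ⟨P, _, hS.mono ?_, fun α β => ⟨?_, ?_⟩⟩
  · nlinarith [mul_nonneg he0 hγ]
  · linear_combination hP1 α β
  · ring

lemma Dker_eq {f g : ℝ → ℝ} {α β : ℝ} (hs : Real.sin (β / 2) ≠ 0) {E P : ℂ}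
    (hE : E * (1 - doubleChar 0 1 α β) = f (α - β) - f α)
    (hP : P * (-doubleChar 0 1 α β * E ^ 2 + (1 + f α) * (1 + f (α - β))) = 1) :
    (Dker f g α β : ℂ) = 1 / 2 * g (α - β) +
      ((1 - doubleChar 0 1 α β) * (1 / 2) * doubleChar 0 1 α β * E ^ 2 +
        (-doubleChar 0 1 α β * (1 + f α) * E - Complex.I / 2 * (1 + doubleChar 0 1 α β) *
          (1 + f (α - β)) * (deriv f α : ℝ))) * g (α - β) * P *
        (1 - doubleChar 0 1 α β)⁻¹ := by
  set x : ℂ := Complex.exp (-Complex.I * (β / 2 : ℝ)) with hx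
  have hx0 : x ≠ 0 := Complex.exp_ne_zero _
  have hs' : (Real.sin (β / 2) : ℂ) ≠ 0 := by exact_mod_cast hs
  have hw : doubleChar 0 1 α β = x ^ 2 := by
    rw [hx, ← Complex.exp_nat_mul]; unfold doubleChar; congr 1; push_cast; ring
  have h1w : 1 - doubleChar 0 1 α β = 2 * Complex.I * (Real.sin (β / 2) : ℂ) * x :=
    one_sub_doubleChar α β
  have hxcs : x = Real.cos (β / 2) - Complex.I * Real.sin (β / 2) := by
    have : x = Complex.exp (((-(β / 2) : ℝ) : ℂ) * Complex.I) := by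
      rw [hx]; congr 1; push_cast; ring
    rw [this, Complex.exp_mul_I, ← Complex.ofReal_cos, ← Complex.ofReal_sin, Real.cos_neg,
      Real.sin_neg]
    push_cast; ring
  have h1pw : 1 + doubleChar 0 1 α β = 2 * (Real.cos (β / 2) : ℂ) * x := by
    rw [hw] at h1w ⊢
    linear_combination h1w + 2 * x * hxcs
  have hΔ : ((f (α - β) : ℂ) - f α) / (2 * Real.sin (β / 2)) = Complex.I * x * E := by
    rw [← hE, h1w]; field_simp
  have hQ : (-doubleChar 0 1 α β * E ^ 2 + (1 + f α) * (1 + f (α - β))) ≠ 0 :=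
    right_ne_zero_of_mul_eq_one hP
  have hden : (Complex.I * x * E) ^ 2 + (1 + (f α : ℂ)) * (1 + f (α - β)) = P⁻¹ := by
    rw [← eq_inv_of_mul_eq_one_right hP, hw]
    linear_combination x ^ 2 * E ^ 2 * Complex.I_sq
  have hP0 : P ≠ 0 := left_ne_zero_of_mul_eq_one hP
  unfold Dker
  simp only [Complex.ofReal_mul, Complex.ofReal_div, Complex.ofReal_sub, Complex.ofReal_add,
    Complex.ofReal_pow, Complex.ofReal_one, Complex.ofReal_ofNat]
  rw [hΔ, hden, h1w, h1pw]
  rw [hw] at hP ⊢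
  have hI := Complex.I_ne_zero
  field_simp
  linear_combination (g (α - β) : ℂ) * Complex.I * Real.sin (β / 2) * hP +
    (g (α - β) : ℂ) * P * (1 + f α) * x * E * Complex.I_sq

end Kernel

/-! ### The operator `D[f]` on absolutely convergent Fourier series -/

section Operator

variable {ω δ : ℝ}

lemma doubleChar_zero_right (k : ℤ) (α β : ℝ) : doubleChar k 0 α β = doubleChar k 0 α 0 := by
  simp [doubleChar]

lemma doubleChar_self (k : ℤ) (α β : ℝ) : doubleChar k k α β = doubleChar k 0 (α - β) 0 := by
  unfold doubleChar; congr 1; push_cast; ring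

lemma isWiener_shift {u : ℝ → ℝ} {c : ℝ}
    (hu : ∀ α, HasSum (fun n => fourierCoef u n * doubleChar n 0 α 0) (u α : ℂ))
    (h : ∑' n, ENNReal.ofReal (wienerWeight ω δ n n * ‖fourierCoef u n‖) ≤ ENNReal.ofReal c) :
    IsWiener ω δ (fun α β => u (α - β)) c :=
  ⟨ℤ, inferInstance, fourierCoef u, id, id, h, fun α β => by
    simpa only [id, doubleChar_self] using hu (α - β)⟩

lemma isWiener_const_right {a : ℤ → ℂ} {v : ℝ → ℂ} {c : ℝ} (hδ : 0 ≤ δ)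
    (hu : ∀ α, HasSum (fun n => a n * doubleChar n 0 α 0) (v α))
    (h : ∑' n, ENNReal.ofReal (wienerWeight ω δ n n * ‖a n‖) ≤ ENNReal.ofReal c) :
    IsWiener ω δ (fun α _ => v α) c := by
  refine ⟨ℤ, inferInstance, a, id, fun _ => 0, le_trans (ENNReal.tsum_le_tsum fun n =>
    ENNReal.ofReal_le_ofReal (mul_le_mul_of_nonneg_right (wienerWeight_mono hδ n (by simp))
      (norm_nonneg _))) h, fun α β => ?_⟩
  simpa only [id, doubleChar_zero_right _ α β] using hu α

lemma exists_dividedDifference (hω : 0 ≤ ω) (hδ : 0 ≤ δ) {u : ℝ → ℝ} {c : ℝ}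
    (hu : ∀ α, HasSum (fun n => fourierCoef u n * doubleChar n 0 α 0) (u α : ℂ))
    (h : ∑' n : ℤ, ENNReal.ofReal (|(n : ℝ)| * (wienerWeight ω δ n n * ‖fourierCoef u n‖)) ≤
      ENNReal.ofReal c) :
    ∃ E, IsWiener ω δ E c ∧ ∀ α β, E α β * (1 - doubleChar 0 1 α β) = u (α - β) - u α := by
  choose H hH1 hH2 using exists_dividedDifference_doubleChar (ω := ω) (δ := δ) hω hδ
  obtain ⟨E, hE1, hE2⟩ := IsWiener.hasSum (G := fun n α β => fourierCoef u n * H n α β)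
    (c := c) hω hδ
    (fun n => (IsWiener.const (fourierCoef u n)).mul hω hδ (norm_nonneg _) (hH1 n)) (by
      refine le_trans (le_of_eq ?_) h
      congr 1; funext n; congr 1; ring)
  refine ⟨E, hE1, fun α β => ?_⟩
  refine ((hE2 α β).mul_right _).unique ?_
  convert! (hu (α - β)).sub (hu α) using 2 with n
  rw [mul_assoc, hH2, doubleChar_self, doubleChar_zero_right _ α β]
  ring

lemma integral_comp_sub_eq_zero {g : ℝ → ℝ} (hp : Function.Periodic g (2 * Real.pi))
    (hg : fourierCoef g 0 = 0) (α : ℝ) :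
    ∫ β in (-Real.pi)..Real.pi, (g (α - β) : ℂ) = 0 := by
  have hpi : (Real.pi : ℂ) ≠ 0 := by exact_mod_cast Real.pi_ne_zero
  have h0 : ∫ β in (-Real.pi)..Real.pi, (g β : ℂ) = 0 := by
    simpa [fourierCoef, hpi] using hg
  have hp' : Function.Periodic (fun x => (g x : ℂ)) (2 * Real.pi) := fun x => by
    simp only [hp x]
  rw [intervalIntegral.integral_comp_sub_left (fun x => (g x : ℂ)) α]
  have h1 := hp'.intervalIntegral_add_eq (α - Real.pi) (-Real.pi)
  rw [show α - Real.pi + 2 * Real.pi = α - -Real.pi by ring,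
    show -Real.pi + 2 * Real.pi = Real.pi by ring, h0] at h1
  exact h1

lemma ofReal_Dapprox_eq {f g : ℝ → ℝ} {S : ℝ → ℝ → ℂ} {α ε : ℝ} (h0 : 0 < ε) (h1 : ε ≤ Real.pi)
    (hg : Continuous g) (hS : Continuous (S α))
    (h : ∀ β, Real.sin (β / 2) ≠ 0 → (Dker f g α β : ℂ) =
      1 / 2 * g (α - β) + S α β * (1 - doubleChar 0 1 0 β)⁻¹) :
    (Dapprox f g α ε : ℂ) =
      1 / 2 * ((1 / (2 * Real.pi)) * truncIntegral (fun β => (g (α - β) : ℂ)) ε) +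
      (1 / (2 * Real.pi)) * truncIntegral (fun β => S α β * (1 - doubleChar 0 1 0 β)⁻¹) ε := by
  obtain ⟨hc1, hc2⟩ := continuousOn_inv_one_sub_doubleChar h0 h1 0
  have hgc : Continuous fun β => (1 / 2 * (g (α - β) : ℂ)) := by fun_prop
  have key {a b : ℝ} (hs : ∀ β ∈ Set.uIcc a b, Real.sin (β / 2) ≠ 0)
      (hc : ContinuousOn (fun β => (1 - doubleChar 0 1 0 β)⁻¹) (Set.uIcc a b)) :
      ((∫ β in a..b, Dker f g α β : ℝ) : ℂ) = 1 / 2 * (∫ β in a..b, (g (α - β) : ℂ)) +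
        ∫ β in a..b, S α β * (1 - doubleChar 0 1 0 β)⁻¹ := by
    have hi : IntervalIntegrable (fun β => S α β * (1 - doubleChar 0 1 0 β)⁻¹) volume a b :=
      (hS.continuousOn.mul hc).intervalIntegrable
    rw [← intervalIntegral.integral_const_mul, ← intervalIntegral.integral_add
      (hgc.intervalIntegrable a b) hi,
      ← intervalIntegral.integral_ofReal]
    exact intervalIntegral.integral_congr fun β hβ => h β (hs β hβ)
  unfold Dapprox truncIntegral
  push_cast
  rw [key (fun β hβ => sin_half_ne_zero_of_mem_uIcc h0 h1 (Or.inl hβ)) hc1,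
    key (fun β hβ => sin_half_ne_zero_of_mem_uIcc h0 h1 (Or.inr hβ)) hc2]
  ring

/-- The Fourier series of `D[f](g)` is small in the weighted Wiener algebra. -/
lemma exists_hasSum_of_isD (hω : 0 ≤ ω) (hδ : 0 < δ) (hδ1 : δ ≤ 1) {e γ : ℝ} (he0 : 0 ≤ e)
    (he : e ≤ 1 / 36) (hγ : 0 ≤ γ) {f g Dg : ℝ → ℝ}
    (hfp : Function.Periodic f (2 * Real.pi)) (hfc : Continuous f)
    (hf : ∑' n, ENNReal.ofReal (wienerWeight ω δ n n * ‖fourierCoef f n‖) ≤ ENNReal.ofReal e)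
    (hf1 : ∑' n : ℤ, ENNReal.ofReal (|(n : ℝ)| * (wienerWeight ω δ n n * ‖fourierCoef f n‖)) ≤
      ENNReal.ofReal e)
    (hgp : Function.Periodic g (2 * Real.pi)) (hgc : Continuous g) (hg0 : fourierCoef g 0 = 0)
    (hg : ∑' n, ENNReal.ofReal (wienerWeight ω δ n n * ‖fourierCoef g n‖) ≤ ENNReal.ofReal γ)
    (hD : IsD f g Dg) :
    ∃ (ι : Type) (_ : Countable ι) (b : ι → ℂ) (k : ι → ℤ),
      ∑' i, ENNReal.ofReal (wienerWeight ω δ (k i) 0 * ‖b i‖) ≤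
        ENNReal.ofReal (9 * e * γ / 2) ∧
      ∀ α, HasSum (fun i => b i * doubleChar (k i) 0 α 0) (Dg α : ℂ) := by
  have hδ' := hδ.le
  have hfs := summable_norm_of_weight hω hδ' hf
  have hfs1 : Summable fun n : ℤ => |(n : ℝ)| * ‖fourierCoef f n‖ := by
    refine (summable_of_tsum_ofReal_le (fun n => ?_) hf1).of_nonneg_of_le
      (fun n => by positivity) fun n => ?_
    · have := one_le_wienerWeight hω hδ' n n
      positivity
    · exact mul_le_mul_of_nonneg_left (le_mul_of_one_le_left (norm_nonneg _)
        (one_le_wienerWeight hω hδ' n n)) (abs_nonneg _)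
  have hfS := hasSum_fourierSeries hfp hfc hfs
  have hgS := hasSum_fourierSeries hgp hgc (summable_norm_of_weight hω hδ' hg)
  have hdf := hasSum_deriv_fourierSeries hfp hfc hfs hfs1
  have hd : IsWiener ω δ (fun α _ => ((deriv f α : ℝ) : ℂ)) e := by
    refine isWiener_const_right hδ' hdf (le_trans (le_of_eq ?_) hf1)
    congr 1; funext n; congr 1
    rw [norm_mul, norm_mul, Complex.norm_I, Complex.norm_intCast]
    ring
  obtain ⟨E, hE, hE1⟩ := exists_dividedDifference hω hδ' hfS hf1
  obtain ⟨P, S, hS, hPS⟩ := exists_kernel hω hδ' hδ1 he0 he hγ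
    (isWiener_const_right hδ' hfS hf) (isWiener_shift hfS hf) hd hE (isWiener_shift hgS hg)
  obtain ⟨ι, hι, b, k, V, hb, hV, hlim⟩ := exists_principalValue hω hδ hS
  refine ⟨ι, hι, b, k, hb, fun α => ?_⟩
  suffices h : (Dg α : ℂ) = V α by rw [h]; exact hV α
  have h1 : Tendsto (fun ε => (Dapprox f g α ε : ℂ)) (nhdsWithin 0 (Set.Ioi 0))
      (nhds (Dg α : ℂ)) := (Complex.continuous_ofReal.tendsto _).comp (hD α)
  have h2 := ((tendsto_truncIntegral (φ := fun β => (g (α - β) : ℂ))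
    (by fun_prop)).const_mul (1 / (2 * Real.pi) : ℂ)).const_mul (1 / 2 : ℂ)
  rw [integral_comp_sub_eq_zero hgp hg0, mul_zero, mul_zero] at h2
  have h3 := h2.add (hlim α)
  rw [zero_add] at h3
  refine tendsto_nhds_unique h1 (h3.congr' ?_)
  filter_upwards [Ioc_mem_nhdsGT Real.pi_pos] with ε hε
  refine (ofReal_Dapprox_eq hε.1 hε.2 hgc (hS.continuous hω hδ' α) fun β hs => ?_).symm
  obtain ⟨hP, hSe⟩ := hPS α β
  rw [Dker_eq hs (hE1 α β) hP, hSe]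
  congr 2
  simp [doubleChar]

end Operator

/-! ### Comparison of the weighted sums with the analytic Wiener norms -/

section Norms

variable {ν t δ : ℝ}

lemma tsum_abs_mul_wienerWeight_le (hδ : 0 ≤ δ) (f : ℝ → ℝ) :
    ∑' n : ℤ, ENNReal.ofReal (|(n : ℝ)| * (wienerWeight (ν * t) δ n n * ‖fourierCoef f n‖)) ≤
      wienerNorm ν t 1 f + ENNReal.ofReal (2 * δ) * wienerNorm ν t 2 f := by
  unfold wienerNorm
  rw [← ENNReal.tsum_mul_left, ← ENNReal.tsum_add]
  refine ENNReal.tsum_le_tsum fun n => ?_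
  split_ifs with hn
  · simp [hn]
  · rw [← ENNReal.ofReal_mul (by positivity), ← ENNReal.ofReal_add (by positivity)
      (by positivity), Real.rpow_one, Real.rpow_two]
    refine ENNReal.ofReal_le_ofReal (le_of_eq ?_)
    rw [wienerWeight, show ν * |(n : ℝ)| * t = ν * t * |(n : ℝ)| by ring]
    ring

lemma tsum_wienerWeight_le (hδ : 0 ≤ δ) (f : ℝ → ℝ) :
    ∑' n : ℤ, ENNReal.ofReal (wienerWeight (ν * t) δ n n * ‖fourierCoef f n‖) ≤
      wienerNormF ν t 1 f + ENNReal.ofReal (2 * δ) * wienerNorm ν t 2 f := by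
  rw [wienerNormF, add_assoc]
  refine le_trans ?_ (add_le_add_right (tsum_abs_mul_wienerWeight_le hδ f) _)
  rw [← tsum_ite_eq (0 : ℤ) (fun n => ENNReal.ofReal ‖fourierCoef f n‖), ← ENNReal.tsum_add]
  refine ENNReal.tsum_le_tsum fun n => ?_
  split_ifs with hn
  · simp [hn, wienerWeight]
  · rw [zero_add]
    refine ENNReal.ofReal_le_ofReal (le_mul_of_one_le_left ?_ ?_)
    · unfold wienerWeight; positivity
    · exact_mod_cast Int.one_le_abs hn

lemma tsum_wienerWeight_eq (hδ : 0 ≤ δ) {u : ℝ → ℝ} (hu : fourierCoef u 0 = 0) :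
    ∑' n : ℤ, ENNReal.ofReal (wienerWeight (ν * t) δ n 0 * ‖fourierCoef u n‖) =
      wienerNorm ν t 0 u + ENNReal.ofReal δ * wienerNorm ν t 1 u := by
  unfold wienerNorm
  rw [← ENNReal.tsum_mul_left, ← ENNReal.tsum_add]
  congr 1; funext n
  split_ifs with hn
  · simp [hn, hu]
  · rw [← ENNReal.ofReal_mul (by positivity), ← ENNReal.ofReal_add (by positivity)
      (by positivity), Real.rpow_one, Real.rpow_zero]
    congr 1
    rw [wienerWeight, show ν * |(n : ℝ)| * t = ν * t * |(n : ℝ)| by ring]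
    push_cast; rw [abs_zero]; ring

lemma wienerNorm_zero_le_one (u : ℝ → ℝ) : wienerNorm ν t 0 u ≤ wienerNorm ν t 1 u := by
  refine ENNReal.tsum_le_tsum fun n => ?_
  split_ifs with hn
  · rfl
  · have h1 : (1 : ℝ) ≤ |(n : ℝ)| := by exact_mod_cast Int.one_le_abs hn
    rw [Real.rpow_zero, Real.rpow_one]
    gcongr

lemma tsum_wienerWeight_self_le {ω : ℝ} (u : ℝ → ℝ) :
    ∑' n : ℤ, ENNReal.ofReal (wienerWeight ω δ n n * ‖fourierCoef u n‖) ≤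
      ENNReal.ofReal 2 * ∑' n : ℤ, ENNReal.ofReal (wienerWeight ω δ n 0 * ‖fourierCoef u n‖) := by
  rw [← ENNReal.tsum_mul_left]
  refine ENNReal.tsum_le_tsum fun n => ?_
  rw [← ENNReal.ofReal_mul zero_le_two, ← mul_assoc]
  refine ENNReal.ofReal_le_ofReal (mul_le_mul_of_nonneg_right ?_ (norm_nonneg _))
  unfold wienerWeight
  rw [mul_left_comm]
  refine mul_le_mul_of_nonneg_left ?_ (Real.exp_pos _).le
  push_cast; rw [abs_zero]; linarith

lemma fourierCoef_sub {u v : ℝ → ℝ} (hu : Continuous u) (hv : Continuous v) (n : ℤ) :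
    fourierCoef (fun α => u α - v α) n = fourierCoef u n - fourierCoef v n := by
  unfold fourierCoef
  rw [← mul_sub, ← intervalIntegral.integral_sub]
  · congr 2; funext α; push_cast; ring
  all_goals exact Continuous.intervalIntegrable (by fun_prop) _ _

/-- The weighted estimate for solutions of `g = 2 A D[f](g) + F`. -/
lemma tsum_wienerWeight_solution_le {ω : ℝ} (hω : 0 ≤ ω) (hδ : 0 < δ) (hδ1 : δ ≤ 1) {A : ℝ}
    (hA : |A| ≤ 1) {f F g Dg : ℝ → ℝ}
    (hfp : Function.Periodic f (2 * Real.pi)) (hfc : Continuous f)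
    (hf : ∑' n, ENNReal.ofReal (wienerWeight ω δ n n * ‖fourierCoef f n‖) ≤
      ENNReal.ofReal (1 / 36))
    (hf1 : ∑' n : ℤ, ENNReal.ofReal (|(n : ℝ)| * (wienerWeight ω δ n n * ‖fourierCoef f n‖)) ≤
      ENNReal.ofReal (1 / 36))
    (hFc : Continuous F) (hgp : Function.Periodic g (2 * Real.pi)) (hgc : Continuous g)
    (hg0 : fourierCoef g 0 = 0)
    (hg : ∑' n, ENNReal.ofReal (wienerWeight ω δ n 0 * ‖fourierCoef g n‖) ≠ ⊤)
    (hD : IsD f g Dg) (h : ∀ α, g α = 2 * A * Dg α + F α) :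
    ∑' n, ENNReal.ofReal (wienerWeight ω δ n 0 * ‖fourierCoef g n‖) ≤
      2 * ∑' n, ENNReal.ofReal (wienerWeight ω δ n 0 * ‖fourierCoef F n‖) := by
  set N := ∑' n, ENNReal.ofReal (wienerWeight ω δ n 0 * ‖fourierCoef g n‖) with hN
  have hw (k m : ℤ) : 0 ≤ wienerWeight ω δ k m :=
    zero_le_one.trans (one_le_wienerWeight hω hδ.le k m)
  have hγ : ∑' n, ENNReal.ofReal (wienerWeight ω δ n n * ‖fourierCoef g n‖) ≤
      ENNReal.ofReal (2 * N.toReal) := by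
    rw [ENNReal.ofReal_mul zero_le_two, ENNReal.ofReal_toReal hg]
    exact tsum_wienerWeight_self_le g
  obtain ⟨ι, hι, b, k, hb, hsum⟩ := exists_hasSum_of_isD hω hδ hδ1 (by norm_num) le_rfl
    (by positivity) hfp hfc hf hf1 hgp hgc hg0 hγ hD
  have hbs := summable_norm_of_weight hω hδ.le hb
  have hu (α : ℝ) : HasSum (fun i => (2 * A * b i) * doubleChar (k i) 0 α 0)
      ((g α - F α : ℝ) : ℂ) := by
    rw [h α]
    convert! (hsum α).mul_left (2 * A : ℂ) using 1
    · funext i; ring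
    · push_cast; ring
  have h1 := tsum_weight_fourierCoef_le (w := fun n => wienerWeight ω δ n 0)
    (b := fun i => 2 * A * b i) (by simpa only [norm_mul] using hbs.mul_left _) hu
    fun n => hw n 0
  have h2 : ∑' i, ENNReal.ofReal (wienerWeight ω δ (k i) 0 * ‖2 * A * b i‖) ≤
      ENNReal.ofReal (N.toReal / 2) := by
    have h3 (i : ι) : ENNReal.ofReal (wienerWeight ω δ (k i) 0 * ‖2 * A * b i‖) ≤
        ENNReal.ofReal 2 * ENNReal.ofReal (wienerWeight ω δ (k i) 0 * ‖b i‖) := by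
      rw [← ENNReal.ofReal_mul zero_le_two, norm_mul, norm_mul, Complex.norm_real,
        Complex.norm_ofNat, Real.norm_eq_abs]
      refine ENNReal.ofReal_le_ofReal ?_
      have := mul_le_of_le_one_left (mul_nonneg (hw (k i) 0) (norm_nonneg (b i))) hA
      linarith
    refine (ENNReal.tsum_le_tsum h3).trans ?_
    rw [ENNReal.tsum_mul_left]
    refine (mul_le_mul_right hb _).trans (le_of_eq ?_)
    rw [← ENNReal.ofReal_mul zero_le_two]
    congr 1; ring
  have h4 : N ≤ N / 2 + ∑' n, ENNReal.ofReal (wienerWeight ω δ n 0 * ‖fourierCoef F n‖) := by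
    have h5 : ENNReal.ofReal (N.toReal / 2) = N / 2 := by
      rw [ENNReal.ofReal_div_of_pos two_pos, ENNReal.ofReal_toReal hg, ENNReal.ofReal_ofNat]
    rw [← h5]
    refine le_trans ?_ (add_le_add_left (h1.trans h2) _)
    rw [← ENNReal.tsum_add]
    refine ENNReal.tsum_le_tsum fun n => ?_
    rw [← ENNReal.ofReal_add (mul_nonneg (hw _ _) (norm_nonneg _))
      (mul_nonneg (hw _ _) (norm_nonneg _)), ← mul_add, fourierCoef_sub hgc hFc]
    refine ENNReal.ofReal_le_ofReal (mul_le_mul_of_nonneg_left ?_ (hw _ _))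
    exact norm_le_norm_sub_add _ _
  rcases eq_or_ne (∑' n, ENNReal.ofReal (wienerWeight ω δ n 0 * ‖fourierCoef F n‖)) ⊤ with hF | hF
  · rw [hF, ENNReal.mul_top two_ne_zero]; exact le_top
  · have h6 := ENNReal.toReal_mono (by finiteness) h4
    rw [ENNReal.toReal_add (by finiteness) hF, ENNReal.toReal_div, ENNReal.toReal_ofNat] at h6
    rw [← ENNReal.toReal_le_toReal hg (by finiteness), ENNReal.toReal_mul, ENNReal.toReal_ofNat]
    linarith

end Norms

/-- Proposition 4.3: any mean-zero solution `g` of the vorticity equation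
`g = 2A_μ D[f](g) + F` with `‖f‖_{F^{1,1}_ν} ≤ ε` small satisfies
`‖g‖_{Ḟ^{1,1}_ν} ≤ C (‖f‖_{Ḟ^{2,1}_ν}‖F‖_{Ḟ^{0,1}_ν} + ‖F‖_{Ḟ^{1,1}_ν})`. -/
theorem vorticity_solution_F11_estimate :
    ∃ ε : ℝ, 0 < ε ∧ ∃ C : ℝ, 0 < C ∧
      ∀ ν t : ℝ, 0 ≤ ν → 0 ≤ t → ∀ Aμ : ℝ, Aμ ∈ Set.Icc (-1 : ℝ) 1 →
      ∀ f F g : ℝ → ℝ,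
        Function.Periodic f (2 * Real.pi) → Continuous f →
        wienerNormF ν t 1 f ≤ ENNReal.ofReal ε → wienerNorm ν t 2 f ≠ ⊤ →
        Function.Periodic F (2 * Real.pi) → Continuous F →
        fourierCoef F 0 = 0 → wienerNorm ν t 1 F ≠ ⊤ →
        Function.Periodic g (2 * Real.pi) → Continuous g →
        fourierCoef g 0 = 0 → wienerNorm ν t 1 g ≠ ⊤ →
        (∃ Dg : ℝ → ℝ, IsD f g Dg ∧ ∀ α : ℝ, g α = 2 * Aμ * Dg α + F α) →
        wienerNorm ν t 1 g ≤ ENNReal.ofReal C *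
          (wienerNorm ν t 2 f * wienerNorm ν t 0 F + wienerNorm ν t 1 F) := by
  refine ⟨1 / 108, by norm_num, 216, by norm_num, ?_⟩
  intro ν t hν ht A hA f F g hfp hfc hf1 hf2 hFp hFc hF0 hF1 hgp hgc hg0 hg1 ⟨Dg, hD, hDg⟩
  have hω : 0 ≤ ν * t := mul_nonneg hν ht
  set N := (wienerNorm ν t 2 f).toReal with hN
  have hN0 : 0 ≤ N := ENNReal.toReal_nonneg
  have hδ : 0 < (1 + 108 * N)⁻¹ := by positivity
  have hδ1 : (1 + 108 * N)⁻¹ ≤ 1 := inv_le_one_of_one_le₀ (by linarith)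
  have hδN : (1 + 108 * N)⁻¹ * (1 + 108 * N) = 1 := inv_mul_cancel₀ (by positivity)
  set δ := (1 + 108 * N)⁻¹
  have hsmall : wienerNormF ν t 1 f + ENNReal.ofReal (2 * δ) * wienerNorm ν t 2 f ≤
      ENNReal.ofReal (1 / 36) := by
    rw [← ENNReal.ofReal_toReal hf2, ← ENNReal.ofReal_mul (by positivity)]
    refine (add_le_add_left hf1 _).trans ?_
    rw [← ENNReal.ofReal_add (by norm_num) (by positivity)]
    exact ENNReal.ofReal_le_ofReal (by linarith)
  have hg0' : wienerNorm ν t 0 g ≠ ⊤ := ne_top_of_le_ne_top hg1 (wienerNorm_zero_le_one g)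
  have hF0' : wienerNorm ν t 0 F ≠ ⊤ := ne_top_of_le_ne_top hF1 (wienerNorm_zero_le_one F)
  have hest := tsum_wienerWeight_solution_le hω hδ hδ1 (abs_le.2 hA) hfp hfc
    ((tsum_wienerWeight_le hδ.le f).trans hsmall)
    ((tsum_abs_mul_wienerWeight_le hδ.le f).trans
      ((add_le_add_left le_add_self _).trans hsmall))
    hFc hgp hgc hg0 (by rw [tsum_wienerWeight_eq hδ.le hg0]; finiteness) hD hDg
  rw [tsum_wienerWeight_eq hδ.le hg0, tsum_wienerWeight_eq hδ.le hF0] at hest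
  have hest' := ENNReal.toReal_mono (by finiteness) (le_add_self.trans hest)
  rw [ENNReal.toReal_mul, ENNReal.toReal_mul, ENNReal.toReal_add (by finiteness) (by finiteness),
    ENNReal.toReal_mul, ENNReal.toReal_ofReal hδ.le, ENNReal.toReal_ofNat] at hest'
  have h01 := ENNReal.toReal_mono hF1 (wienerNorm_zero_le_one (ν := ν) (t := t) F)
  rw [← ENNReal.toReal_le_toReal hg1 (by finiteness), ENNReal.toReal_mul,
    ENNReal.toReal_add (by finiteness) hF1, ENNReal.toReal_mul,
    ENNReal.toReal_ofReal (by norm_num), ← hN]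
  have h := mul_le_mul_of_nonneg_left hest' (by positivity : 0 ≤ 1 + 108 * N)
  have hF00 : 0 ≤ (wienerNorm ν t 0 F).toReal := ENNReal.toReal_nonneg
  generalize (wienerNorm ν t 1 g).toReal = G at *
  generalize (wienerNorm ν t 1 F).toReal = F₁ at *
  generalize (wienerNorm ν t 0 F).toReal = F₀ at *
  have h' : G ≤ 2 * ((1 + 108 * N) * F₀ + F₁) := by
    linear_combination h + (2 * F₁ - G) * hδN
  linarith [mul_nonneg hN0 hF00]
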